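/- Let q and ℓ be positive integers. The map (d, f, g, ν₁, γ) ↦ (n₁, r, c) = (ν₁ f, f g d, g γ) is a bijection from the set of quintuples (d, f, g, ν₁, γ) of positive integers satisfying ℓ ∣ f g d, q ∣ f g ν₁ γ, gcd(ν₁, g) = 1 and gcd(ν₁ γ, d) = 1, onto the set of triples (n₁, r, c) of positive integers satisfying q ∣ n₁ c and ℓ ∣ r. Its inverse is given by (n₁, r, c) ↦ ( r/(n₁ c, r), (n₁, r), (n₁ c, r)/(n₁, r), n₁/(n₁, r), c (n₁, r)/(n₁ c, r) ), where (·,·) denotes the greatest common divisor. -/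

import Mathlib

/-- The quintuples `(d, f, g, ν₁, γ)` of positive integers with `ℓ ∣ f g d`, `q ∣ f g ν₁ γ`,
`(ν₁, g) = 1` and `(ν₁ γ, d) = 1`. -/
def quintSet (q ℓ : ℕ) : Set (ℕ × ℕ × ℕ × ℕ × ℕ) :=
  {p | 0 < p.1 ∧ 0 < p.2.1 ∧ 0 < p.2.2.1 ∧ 0 < p.2.2.2.1 ∧ 0 < p.2.2.2.2 ∧
    ℓ ∣ p.2.1 * p.2.2.1 * p.1 ∧ q ∣ p.2.1 * p.2.2.1 * p.2.2.2.1 * p.2.2.2.2 ∧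
    Nat.gcd p.2.2.2.1 p.2.2.1 = 1 ∧ Nat.gcd (p.2.2.2.1 * p.2.2.2.2) p.1 = 1}

/-- The triples `(n₁, r, c)` of positive integers with `q ∣ n₁ c` and `ℓ ∣ r`. -/
def tripleSet (q ℓ : ℕ) : Set (ℕ × ℕ × ℕ) :=
  {p | 0 < p.1 ∧ 0 < p.2.1 ∧ 0 < p.2.2 ∧ q ∣ p.1 * p.2.2 ∧ ℓ ∣ p.2.1}

/-- `(d, f, g, ν₁, γ) ↦ (ν₁ f, f g d, g γ)`. -/
def forwardMap : ℕ × ℕ × ℕ × ℕ × ℕ → ℕ × ℕ × ℕ :=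
  fun p => (p.2.2.2.1 * p.2.1, p.2.1 * p.2.2.1 * p.1, p.2.2.1 * p.2.2.2.2)

/-- `(n₁, r, c) ↦ (r/(n₁c, r), (n₁, r), (n₁c, r)/(n₁, r), n₁/(n₁, r), c(n₁, r)/(n₁c, r))`. -/
def backwardMap : ℕ × ℕ × ℕ → ℕ × ℕ × ℕ × ℕ × ℕ :=
  fun p => (p.2.1 / Nat.gcd (p.1 * p.2.2) p.2.1, Nat.gcd p.1 p.2.1,
    Nat.gcd (p.1 * p.2.2) p.2.1 / Nat.gcd p.1 p.2.1, p.1 / Nat.gcd p.1 p.2.1,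
    p.2.2 * Nat.gcd p.1 p.2.1 / Nat.gcd (p.1 * p.2.2) p.2.1)

theorem mapsTo_forwardMap (q ℓ : ℕ) :
    Set.MapsTo forwardMap (quintSet q ℓ) (tripleSet q ℓ) := by
  rintro ⟨d, f, g, ν, γ⟩ ⟨hd, hf, hg, hν, hγ, hℓ, hq, -, -⟩
  simp only at hd hf hg hν hγ hℓ hq
  refine ⟨Nat.mul_pos hν hf, Nat.mul_pos (Nat.mul_pos hf hg) hd, Nat.mul_pos hg hγ, ?_, hℓ⟩
  have h : ν * f * (g * γ) = f * g * ν * γ := by ring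
  simpa only [forwardMap, h] using hq

theorem leftInvOn_backwardMap (q ℓ : ℕ) :
    Set.LeftInvOn backwardMap forwardMap (quintSet q ℓ) := by
  rintro ⟨d, f, g, ν, γ⟩ ⟨hd, hf, hg, hν, hγ, -, -, hνg, hνγd⟩
  simp only at hd hf hg hν hγ hνg hνγd
  have hνd : Nat.Coprime ν d := Nat.Coprime.coprime_mul_right hνγd
  have hgcd₁ : Nat.gcd (ν * f) (f * g * d) = f := by
    rw [mul_comm ν f, mul_assoc, Nat.gcd_mul_left, Nat.Coprime.mul_right hνg hνd, mul_one]
  have hgcd₂ : Nat.gcd (ν * f * (g * γ)) (f * g * d) = f * g := by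
    rw [show ν * f * (g * γ) = f * g * (ν * γ) by ring, Nat.gcd_mul_left, hνγd, mul_one]
  simp only [backwardMap, forwardMap, hgcd₁, hgcd₂, Prod.mk.injEq, true_and]
  refine ⟨Nat.mul_div_cancel_left d (Nat.mul_pos hf hg), Nat.mul_div_cancel_left g hf,
    Nat.mul_div_cancel ν hf, ?_⟩
  rw [show g * γ * f = f * g * γ by ring, Nat.mul_div_cancel_left γ (Nat.mul_pos hf hg)]

theorem surjOn_forwardMap (q ℓ : ℕ) :
    Set.SurjOn forwardMap (quintSet q ℓ) (tripleSet q ℓ) := by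
  rintro ⟨n, r, c⟩ ⟨hn, hr, hc, hq, hℓ⟩
  simp only at hn hr hc hq hℓ
  obtain ⟨ν, s, hνs, hn_eq, hr_eq⟩ := Nat.exists_coprime n r
  obtain ⟨γ, d, hγd, hc_eq, hs_eq⟩ := Nat.exists_coprime c s
  generalize Nat.gcd n r = f at hn_eq hr_eq
  generalize Nat.gcd c s = g at hc_eq hs_eq
  subst hn_eq hr_eq hc_eq hs_eq
  have hr_comm : d * g * f = f * g * d := by ring
  have hprod : ν * f * (γ * g) = f * g * ν * γ := by ring
  refine ⟨(d, f, g, ν, γ), ⟨?_, ?_, ?_, ?_, ?_, hr_comm ▸ hℓ, hprod ▸ hq,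
    hνs.coprime_mul_left_right, (hνs.coprime_mul_right_right).mul_left hγd⟩, ?_⟩
  · exact Nat.pos_of_mul_pos_right (Nat.pos_of_mul_pos_right hr)
  · exact Nat.pos_of_mul_pos_left hn
  · exact Nat.pos_of_mul_pos_left hc
  · exact Nat.pos_of_mul_pos_right hn
  · exact Nat.pos_of_mul_pos_right hc
  · simp only [forwardMap, hr_comm, mul_comm g γ]

theorem stmt7 (q ℓ : ℕ) (hq : 0 < q) (hℓ : 0 < ℓ) :
    Set.BijOn forwardMap (quintSet q ℓ) (tripleSet q ℓ) ∧
    Set.InvOn backwardMap forwardMap (quintSet q ℓ) (tripleSet q ℓ) := by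
  have hleft := leftInvOn_backwardMap q ℓ
  have hsurj := surjOn_forwardMap q ℓ
  refine ⟨⟨mapsTo_forwardMap q ℓ, hleft.injOn, hsurj⟩, hleft, fun t ht => ?_⟩
  obtain ⟨p, hp, rfl⟩ := hsurj ht
  rw [hleft hp]
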